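/- arXiv:math/0502119 — 7 statements merged into one kernel-verified Lean document; each statement's English description precedes it below -/
import Mathlib

section
/- For every n ≥ 3, the Lie subalgebra g_n of the group algebra k[S_n] generated by all transpositions is equal to the Lie subalgebra generated by the consecutive transpositions (i, i+1) for 1 ≤ i ≤ n−1, and is also equal to the Lie subalgebra generated by the transpositions (i, n) for 1 ≤ i ≤ n−1. -/
attribute [local instance 100] LieRing.ofAssociativeRing

open MonoidAlgebra in
/-- The set of transpositions `(i j)` inside the group algebra `k[S_n]`. -/
def transpositions (k : Type) [Field k] (n : ℕ) : Set (MonoidAlgebra k (Equiv.Perm (Fin n))) :=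
  {x | ∃ i j : Fin n, i ≠ j ∧ x = MonoidAlgebra.of k (Equiv.Perm (Fin n)) (Equiv.swap i j)}

/-- `g_n`: the Lie subalgebra of the group algebra `k[S_n]` (with the commutator
bracket `⁅a, b⁆ = a * b - b * a`) generated by the transpositions. -/
noncomputable def gn (k : Type) [Field k] (n : ℕ) : LieSubalgebra k (MonoidAlgebra k (Equiv.Perm (Fin n))) :=
  LieSubalgebra.lieSpan k (MonoidAlgebra k (Equiv.Perm (Fin n))) (transpositions k n)

/-- `g'_n = [g_n, g_n]`: the derived subalgebra of `g_n`, the span of all brackets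
of elements of `g_n`. -/
noncomputable def gnDer (k : Type) [Field k] (n : ℕ) : Submodule k (MonoidAlgebra k (Equiv.Perm (Fin n))) :=
  Submodule.span k {x | ∃ a ∈ gn k n, ∃ b ∈ gn k n, x = ⁅a, b⁆}

/-- `T_n`: the sum of all transpositions in `k[S_n]`. -/
noncomputable def sumTranspositions (k : Type) [Field k] (n : ℕ) :
    MonoidAlgebra k (Equiv.Perm (Fin n)) :=
  ∑ p ∈ Finset.univ.filter (fun p : Fin n × Fin n => p.1 < p.2),
    MonoidAlgebra.of k (Equiv.Perm (Fin n)) (Equiv.swap p.1 p.2)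

theorem conj_mem_aux {k : Type} [Field k] [CharZero k] {n : ℕ}
    (L : LieSubalgebra k (MonoidAlgebra k (Equiv.Perm (Fin n))))
    (s t : MonoidAlgebra k (Equiv.Perm (Fin n))) (hs : s ∈ L) (ht : t ∈ L) (h : s * s = 1) :
    s * t * s ∈ L := by
  have e : s * t * s = t - (2⁻¹ : k) • ⁅s, ⁅s, t⁆⁆ := by
    have e1 : ⁅s, ⁅s, t⁆⁆ = (2 : k) • (t - s * t * s) := by
      rw [LieRing.of_associative_ring_bracket, LieRing.of_associative_ring_bracket, mul_sub,
        sub_mul, ← mul_assoc, h, mul_assoc t s s, h, two_smul]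
      simp only [one_mul, mul_one, mul_assoc]
      abel
    rw [e1, smul_smul, inv_mul_cancel₀ two_ne_zero, one_smul]
    abel
  rw [e]
  exact L.sub_mem ht (L.smul_mem _ (L.lie_mem hs (L.lie_mem hs ht)))

theorem swap_mem_aux {k : Type} [Field k] [CharZero k] {n : ℕ}
    (L : LieSubalgebra k (MonoidAlgebra k (Equiv.Perm (Fin n)))) (x y z : Fin n)
    (hxy : x ≠ y) (hxz : x ≠ z)
    (h1 : MonoidAlgebra.of k (Equiv.Perm (Fin n)) (Equiv.swap x y) ∈ L)
    (h2 : MonoidAlgebra.of k (Equiv.Perm (Fin n)) (Equiv.swap y z) ∈ L) :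
    MonoidAlgebra.of k (Equiv.Perm (Fin n)) (Equiv.swap x z) ∈ L := by
  have h := conj_mem_aux L _ _ h2 h1 (by rw [← map_mul, Equiv.swap_mul_self, map_one])
  rw [← map_mul, ← map_mul, Equiv.swap_mul_swap_mul_swap hxy hxz, Equiv.swap_comm] at h
  exact h

/-- For every `n ≥ 3`, the Lie subalgebra `g_n` of `k[S_n]` generated by all
transpositions equals the Lie subalgebra generated by the consecutive
transpositions `(i, i+1)`, `1 ≤ i ≤ n-1`, and also equals the Lie subalgebra
generated by the transpositions `(i, n)`, `1 ≤ i ≤ n-1`.  (Here `Fin n`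
is the set of letters, 0-indexed, so `(i, i+1)` is `Equiv.swap ⟨i-1,_⟩ ⟨i,_⟩`
and the letter `n` is `⟨n-1,_⟩`.) -/
theorem gn_generators (k : Type) [Field k] [CharZero k] (n : ℕ) (hn : 3 ≤ n) :
    gn k n = LieSubalgebra.lieSpan k (MonoidAlgebra k (Equiv.Perm (Fin n)))
      {x | ∃ i : ℕ, ∃ h : i + 1 < n,
        x = MonoidAlgebra.of k (Equiv.Perm (Fin n))
          (Equiv.swap ⟨i, by omega⟩ ⟨i + 1, h⟩)} ∧
    gn k n = LieSubalgebra.lieSpan k (MonoidAlgebra k (Equiv.Perm (Fin n)))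
      {x | ∃ i : ℕ, ∃ h : i + 1 < n,
        x = MonoidAlgebra.of k (Equiv.Perm (Fin n))
          (Equiv.swap ⟨i, by omega⟩ ⟨n - 1, by omega⟩)} := by
  constructor
  · apply le_antisymm
    · rw [gn, LieSubalgebra.lieSpan_le]
      set L := LieSubalgebra.lieSpan k (MonoidAlgebra k (Equiv.Perm (Fin n)))
        {x | ∃ i : ℕ, ∃ h : i + 1 < n, x = MonoidAlgebra.of k (Equiv.Perm (Fin n))
          (Equiv.swap ⟨i, by omega⟩ ⟨i + 1, h⟩)} with hL
      have key : ∀ d i : ℕ, ∀ h : i + d + 1 < n, MonoidAlgebra.of k (Equiv.Perm (Fin n))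
          (Equiv.swap ⟨i, by omega⟩ ⟨i + d + 1, h⟩) ∈ L := by
        intro d
        induction d with
        | zero => intro i h; exact LieSubalgebra.subset_lieSpan ⟨i, h, rfl⟩
        | succ d ih =>
          intro i h
          refine swap_mem_aux L ⟨i, by omega⟩ ⟨i + d + 1, by omega⟩ ⟨i + d + 1 + 1, h⟩ ?_ ?_ (ih i (by omega))
            (LieSubalgebra.subset_lieSpan ⟨i + d + 1, h, rfl⟩)
          · simp only [ne_eq, Fin.mk.injEq]; omega
          · simp only [ne_eq, Fin.mk.injEq]; omega
      have key2 : ∀ i j : Fin n, i < j →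
          MonoidAlgebra.of k (Equiv.Perm (Fin n)) (Equiv.swap i j) ∈ L := by
        rintro ⟨i, hi⟩ ⟨j, hj⟩ hij
        rw [Fin.mk_lt_mk] at hij
        obtain ⟨d, rfl⟩ := Nat.exists_eq_add_of_lt hij
        exact key d i hj
      rintro x ⟨i, j, hij, rfl⟩
      rcases lt_or_gt_of_ne hij with h | h
      · exact key2 i j h
      · rw [Equiv.swap_comm]; exact key2 j i h
    · rw [LieSubalgebra.lieSpan_le]
      rintro x ⟨i, h, rfl⟩
      exact LieSubalgebra.subset_lieSpan ⟨_, _, by simp, rfl⟩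
  · apply le_antisymm
    · rw [gn, LieSubalgebra.lieSpan_le]
      set L := LieSubalgebra.lieSpan k (MonoidAlgebra k (Equiv.Perm (Fin n)))
        {x | ∃ i : ℕ, ∃ h : i + 1 < n, x = MonoidAlgebra.of k (Equiv.Perm (Fin n))
          (Equiv.swap ⟨i, by omega⟩ ⟨n - 1, by omega⟩)} with hL
      have key : ∀ i : Fin n, i ≠ ⟨n - 1, by omega⟩ → MonoidAlgebra.of k (Equiv.Perm (Fin n))
          (Equiv.swap i ⟨n - 1, by omega⟩) ∈ L := by
        rintro ⟨i, hi⟩ h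
        simp only [ne_eq, Fin.mk.injEq] at h
        exact LieSubalgebra.subset_lieSpan ⟨i, by omega, rfl⟩
      rintro x ⟨i, j, hij, rfl⟩
      by_cases hj : j = ⟨n - 1, by omega⟩
      · subst hj; exact key i hij
      by_cases hi : i = ⟨n - 1, by omega⟩
      · subst hi; rw [Equiv.swap_comm]; exact key j hj
      refine swap_mem_aux L i ⟨n - 1, by omega⟩ j hi hij (key i hi) ?_
      rw [Equiv.swap_comm]; exact key j hj
    · rw [LieSubalgebra.lieSpan_le]
      rintro x ⟨i, h, rfl⟩
      refine LieSubalgebra.subset_lieSpan ⟨_, _, ?_, rfl⟩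
      simp only [ne_eq, Fin.mk.injEq]; omega
end

section
/- For every n ≥ 3, the center of the Lie algebra g_n is the one-dimensional subspace k·T_n, and g_n is the direct sum of the ideal k·T_n and its derived subalgebra g'_n = [g_n, g_n]; in particular g_n ≅ k × g'_n as Lie algebras. -/
attribute [local instance 100] LieRing.ofAssociativeRing

open scoped Classical in
/-- sum over all conjugates -/
noncomputable def avgP (k : Type) [Field k] (n : ℕ) :
    MonoidAlgebra k (Equiv.Perm (Fin n)) →ₗ[k] MonoidAlgebra k (Equiv.Perm (Fin n)) :=
  ∑ h : Equiv.Perm (Fin n), (LinearMap.mulLeft k (MonoidAlgebra.of k _ h)).comp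
    (LinearMap.mulRight k (MonoidAlgebra.of k _ h⁻¹))

lemma avgP_apply (k : Type) [Field k] (n : ℕ) (x : MonoidAlgebra k (Equiv.Perm (Fin n))) :
    avgP k n x = ∑ h : Equiv.Perm (Fin n),
      MonoidAlgebra.of k _ h * (x * MonoidAlgebra.of k _ h⁻¹) := by
  simp [avgP, LinearMap.sum_apply]

lemma avgP_comm_of (k : Type) [Field k] (n : ℕ) (a : Equiv.Perm (Fin n))
    (x : MonoidAlgebra k (Equiv.Perm (Fin n))) :
    avgP k n (MonoidAlgebra.of k _ a * x) = avgP k n (x * MonoidAlgebra.of k _ a) := by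
  rw [avgP_apply, avgP_apply]
  refine Fintype.sum_equiv (Equiv.mulRight a) _ _ (fun h => ?_)
  simp only [Equiv.coe_mulRight, mul_inv_rev, map_mul, mul_assoc]
  rw [← mul_assoc (MonoidAlgebra.of k _ a) (MonoidAlgebra.of k _ a⁻¹), ← map_mul]
  simp

lemma avgP_comm (k : Type) [Field k] (n : ℕ)
    (a x : MonoidAlgebra k (Equiv.Perm (Fin n))) :
    avgP k n (a * x) = avgP k n (x * a) := by
  induction a using MonoidAlgebra.induction_on with
  | of g => exact avgP_comm_of k n g x
  | add a b ha hb => simp only [add_mul, mul_add, map_add, ha, hb]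
  | smul r a ha => simp only [smul_mul_assoc, mul_smul_comm, map_smul, ha]

lemma avgP_der (k : Type) [Field k] (n : ℕ) (x : MonoidAlgebra k (Equiv.Perm (Fin n)))
    (hx : x ∈ gnDer k n) : avgP k n x = 0 := by
  have : gnDer k n ≤ LinearMap.ker (avgP k n) := by
    refine Submodule.span_le.2 ?_
    rintro _ ⟨a, -, b, -, rfl⟩
    simp only [SetLike.mem_coe, LinearMap.mem_ker, LieRing.of_associative_ring_bracket, map_sub]
    rw [avgP_comm, sub_self]
  exact this hx

lemma central_der (k : Type) [Field k] [CharZero k] (n : ℕ)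
    (x : MonoidAlgebra k (Equiv.Perm (Fin n)))
    (hx : x ∈ gnDer k n) (hc : ∀ g : Equiv.Perm (Fin n),
      MonoidAlgebra.of k _ g * x = x * MonoidAlgebra.of k _ g) : x = 0 := by
  have h := avgP_der k n x hx
  rw [avgP_apply] at h
  have h2 : ∀ g : Equiv.Perm (Fin n),
      MonoidAlgebra.of k _ g * (x * MonoidAlgebra.of k _ g⁻¹) = x := by
    intro g
    rw [← mul_assoc, hc, mul_assoc, ← map_mul, mul_inv_cancel, map_one, mul_one]
  simp only [h2, Finset.sum_const, Finset.card_univ] at h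
  rw [← Nat.cast_smul_eq_nsmul k] at h
  rcases smul_eq_zero.1 h with h | h
  · exact absurd h (by simp)
  · exact h

lemma commutes_all (k : Type) [Field k] (n : ℕ)
    (x : MonoidAlgebra k (Equiv.Perm (Fin n)))
    (hc : ∀ i j : Fin n, i ≠ j →
      MonoidAlgebra.of k _ (Equiv.swap i j) * x = x * MonoidAlgebra.of k _ (Equiv.swap i j))
    (g : Equiv.Perm (Fin n)) :
      MonoidAlgebra.of k _ g * x = x * MonoidAlgebra.of k _ g := by
  induction g using Equiv.Perm.swap_induction_on with
  | one => rw [map_one, one_mul, mul_one]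
  | swap_mul f i j hij ih =>
    rw [map_mul, mul_assoc, ih, ← mul_assoc, hc i j hij, mul_assoc]

lemma two_T (k : Type) [Field k] (n : ℕ) :
    sumTranspositions k n + sumTranspositions k n =
      ∑ p ∈ Finset.univ.filter (fun p : Fin n × Fin n => p.1 ≠ p.2),
        MonoidAlgebra.of k (Equiv.Perm (Fin n)) (Equiv.swap p.1 p.2) := by
  have h : sumTranspositions k n =
      ∑ p ∈ Finset.univ.filter (fun p : Fin n × Fin n => p.2 < p.1),
        MonoidAlgebra.of k (Equiv.Perm (Fin n)) (Equiv.swap p.1 p.2) := by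
    unfold sumTranspositions
    refine Finset.sum_equiv (Equiv.prodComm _ _) ?_ ?_
    · simp
    · intro p _
      simp [Equiv.swap_comm]
  nth_rewrite 2 [h]
  unfold sumTranspositions
  rw [← Finset.sum_union]
  · refine Finset.sum_congr ?_ (fun _ _ => rfl)
    ext p
    simp [lt_or_lt_iff_ne]
  · rw [Finset.disjoint_filter]
    intro p _ h1 h2
    exact lt_asymm h1 h2

lemma T_central (k : Type) [Field k] [CharZero k] (n : ℕ) (g : Equiv.Perm (Fin n)) :
    MonoidAlgebra.of k _ g * sumTranspositions k n =
      sumTranspositions k n * MonoidAlgebra.of k _ g := by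
  have h : MonoidAlgebra.of k _ g * (sumTranspositions k n + sumTranspositions k n) =
      (sumTranspositions k n + sumTranspositions k n) * MonoidAlgebra.of k _ g := by
    rw [two_T, Finset.mul_sum, Finset.sum_mul]
    refine Finset.sum_equiv (Equiv.prodCongr g g) ?_ ?_
    · simp
    · intro p _
      rw [← map_mul, ← map_mul]
      congr 1
      simp [Equiv.mul_swap_eq_swap_mul]
  rw [mul_add, add_mul, ← two_smul k, ← two_smul k (sumTranspositions k n * _)] at h
  exact smul_right_injective _ (two_ne_zero) h

lemma T_ne (k : Type) [Field k] [CharZero k] (n : ℕ) (hn : 3 ≤ n) :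
    sumTranspositions k n ≠ 0 := by
  intro h
  have := congrArg (MonoidAlgebra.lift k k (Equiv.Perm (Fin n)) 1) h
  simp only [sumTranspositions, map_sum, MonoidAlgebra.lift_of, MonoidHom.one_apply, map_zero,
    Finset.sum_const, nsmul_eq_mul, mul_one, Nat.cast_eq_zero, Finset.card_eq_zero] at this
  have h2 : ((⟨0, by omega⟩, ⟨1, by omega⟩) : Fin n × Fin n) ∈
    Finset.univ.filter (fun p : Fin n × Fin n => p.1 < p.2) := by simp
  rw [this] at h2
  simp at h2

lemma mem_gn (k : Type) [Field k] (n : ℕ) {i j : Fin n} (h : i ≠ j) :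
    MonoidAlgebra.of k _ (Equiv.swap i j) ∈ gn k n :=
  LieSubalgebra.subset_lieSpan ⟨i, j, h, rfl⟩

lemma der_le (k : Type) [Field k] (n : ℕ) : gnDer k n ≤ (gn k n).toSubmodule := by
  refine Submodule.span_le.2 ?_
  rintro _ ⟨a, ha, b, hb, rfl⟩
  exact (gn k n).lie_mem ha hb

lemma T_mem (k : Type) [Field k] (n : ℕ) : sumTranspositions k n ∈ gn k n := by
  change _ ∈ (gn k n).toSubmodule
  refine Submodule.sum_mem _ (fun p hp => mem_gn k n ?_)
  exact (Finset.mem_filter.1 hp).2.ne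

lemma diff_adj (k : Type) [Field k] [CharZero k] (n : ℕ) {a b c : Fin n} (hab : a ≠ b)
    (hbc : b ≠ c) (hac : a ≠ c) :
    MonoidAlgebra.of k (Equiv.Perm (Fin n)) (Equiv.swap b c) -
      MonoidAlgebra.of k _ (Equiv.swap a c) ∈ gnDer k n := by
  have h : ⁅MonoidAlgebra.of k (Equiv.Perm (Fin n)) (Equiv.swap a b),
      ⁅MonoidAlgebra.of k (Equiv.Perm (Fin n)) (Equiv.swap a b),
        MonoidAlgebra.of k (Equiv.Perm (Fin n)) (Equiv.swap b c)⁆⁆ ∈ gnDer k n :=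
    Submodule.subset_span ⟨_, mem_gn k n hab, _, (gn k n).lie_mem (mem_gn k n hab)
      (mem_gn k n hbc), rfl⟩
  have h1 : MonoidAlgebra.of k (Equiv.Perm (Fin n)) (Equiv.swap a b) *
      MonoidAlgebra.of k (Equiv.Perm (Fin n)) (Equiv.swap a b) = 1 := by
    rw [← map_mul, Equiv.swap_mul_self, map_one]
  have h2 : MonoidAlgebra.of k (Equiv.Perm (Fin n)) (Equiv.swap a b) *
      MonoidAlgebra.of k (Equiv.Perm (Fin n)) (Equiv.swap b c) *
      MonoidAlgebra.of k (Equiv.Perm (Fin n)) (Equiv.swap a b) =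
      MonoidAlgebra.of k (Equiv.Perm (Fin n)) (Equiv.swap a c) := by
    rw [← map_mul, ← map_mul, Equiv.mul_swap_eq_swap_mul (Equiv.swap a b) b c, mul_assoc, Equiv.swap_mul_self, mul_one,
      Equiv.swap_apply_right, Equiv.swap_apply_of_ne_of_ne hac.symm hbc.symm]
  rw [← h2]
  generalize MonoidAlgebra.of k (Equiv.Perm (Fin n)) (Equiv.swap a b) = s at *
  generalize MonoidAlgebra.of k (Equiv.Perm (Fin n)) (Equiv.swap b c) = t at *
  have e : ⁅s, ⁅s, t⁆⁆ = (2 : k) • (t - s * t * s) := by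
    simp only [LieRing.of_associative_ring_bracket, two_smul]
    have e1 : s * (s * t - t * s) - (s * t - t * s) * s =
      (s * s) * t - s * t * s - s * t * s + t * (s * s) := by noncomm_ring
    rw [e1, h1]
    noncomm_ring
  rw [e] at h
  exact (Submodule.smul_mem_iff _ two_ne_zero).1 h

lemma diff_any (k : Type) [Field k] [CharZero k] (n : ℕ) {a b c d : Fin n} (hab : a ≠ b)
    (hcd : c ≠ d) :
    MonoidAlgebra.of k (Equiv.Perm (Fin n)) (Equiv.swap a b) -
      MonoidAlgebra.of k _ (Equiv.swap c d) ∈ gnDer k n := by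
  have key : ∀ {a b c : Fin n}, a ≠ b → c ≠ b →
      MonoidAlgebra.of k (Equiv.Perm (Fin n)) (Equiv.swap a b) -
      MonoidAlgebra.of k _ (Equiv.swap c b) ∈ gnDer k n := by
    intro a b c h1 h2
    by_cases h : c = a
    · subst h; simp
    · exact diff_adj k n h h1 h2
  by_cases h : c = b
  · subst h
    have := key hab hcd.symm
    rwa [Equiv.swap_comm d c] at this
  · have h1 := key hab h
    have h2 := key (a := b) (b := c) (c := d) (Ne.symm h) hcd.symm
    have := add_mem h1 h2
    rw [Equiv.swap_comm b c, Equiv.swap_comm d c] at this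
    simpa using this

lemma gn_le (k : Type) [Field k] [CharZero k] (n : ℕ) (hn : 3 ≤ n) :
    (gn k n).toSubmodule ≤ Submodule.span k {sumTranspositions k n} ⊔ gnDer k n := by
  set M := Submodule.span k {sumTranspositions k n} ⊔ gnDer k n with hM
  have hMle : M ≤ (gn k n).toSubmodule :=
    sup_le (Submodule.span_le.2 (by simpa using T_mem k n)) (der_le k n)
  let L : LieSubalgebra k (MonoidAlgebra k (Equiv.Perm (Fin n))) :=
    { M with
      lie_mem' := fun {x y} hx hy =>
        (le_sup_right : gnDer k n ≤ M) (Submodule.subset_span ⟨x, hMle hx, y, hMle hy, rfl⟩) }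
  have hL : gn k n ≤ L := by
    refine LieSubalgebra.lieSpan_le.2 ?_
    rintro _ ⟨i, j, hij, rfl⟩
    change _ ∈ M
    set N := (Finset.univ.filter (fun p : Fin n × Fin n => p.1 < p.2)).card with hN
    have hN0 : (N : k) ≠ 0 := by
      rw [Nat.cast_ne_zero, hN, Finset.card_ne_zero]
      exact ⟨((⟨0, by omega⟩, ⟨1, by omega⟩) : Fin n × Fin n), by simp⟩
    have h1 : (N : k) • MonoidAlgebra.of k (Equiv.Perm (Fin n)) (Equiv.swap i j) -
        sumTranspositions k n ∈ gnDer k n := by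
      rw [Nat.cast_smul_eq_nsmul, hN, ← Finset.sum_const, sumTranspositions,
        ← Finset.sum_sub_distrib]
      refine Submodule.sum_mem _ (fun p hp => diff_any k n hij ?_)
      exact (Finset.mem_filter.1 hp).2.ne
    have h2 := add_mem ((le_sup_right : gnDer k n ≤ M) h1)
      ((le_sup_left : _ ≤ M) (Submodule.mem_span_singleton_self (sumTranspositions k n)))
    rw [sub_add_cancel] at h2
    exact (Submodule.smul_mem_iff _ hN0).1 h2
  exact fun x hx => hL hx

lemma bracket_T (k : Type) [Field k] [CharZero k] (n : ℕ)
    (y : MonoidAlgebra k (Equiv.Perm (Fin n))) :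
    ⁅sumTranspositions k n, y⁆ = 0 := by
  rw [LieRing.of_associative_ring_bracket, sub_eq_zero]
  induction y using MonoidAlgebra.induction_on with
  | of g => exact (T_central k n g).symm
  | add a b ha hb => simp only [add_mul, mul_add, ha, hb]
  | smul r a ha => simp only [smul_mul_assoc, mul_smul_comm, ha]

/-- For every `n ≥ 3`: the center of the Lie algebra `g_n` is the one-dimensional
subspace `k·T_n` (where `T_n` is the sum of all transpositions), and `g_n` is the
direct sum (as a `k`-module) of the ideal `k·T_n` and the derived subalgebra
`g'_n = [g_n, g_n]`; in particular `g_n ≅ k × g'_n` as Lie algebras. -/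
theorem center_and_decomposition (k : Type) [Field k] [CharZero k] (n : ℕ) (hn : 3 ≤ n) :
    sumTranspositions k n ≠ 0 ∧
    {x : MonoidAlgebra k (Equiv.Perm (Fin n)) | x ∈ gn k n ∧ ∀ y ∈ gn k n, ⁅x, y⁆ = 0}
      = (Submodule.span k {sumTranspositions k n} : Set (MonoidAlgebra k (Equiv.Perm (Fin n)))) ∧
    (gn k n).toSubmodule = Submodule.span k {sumTranspositions k n} ⊔ gnDer k n ∧
    Submodule.span k {sumTranspositions k n} ⊓ gnDer k n = ⊥ := by
  refine ⟨T_ne k n hn, ?_, le_antisymm (gn_le k n hn) ?_, ?_⟩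
  · ext x
    constructor
    · rintro ⟨hx, hc⟩
      obtain ⟨t, ht, y, hy, rfl⟩ := Submodule.mem_sup.1 (gn_le k n hn hx)
      obtain ⟨c, rfl⟩ := Submodule.mem_span_singleton.1 ht
      have hy0 : y = 0 := by
        refine central_der k n y hy (commutes_all k n y ?_)
        intro i j hij
        have h := hc _ (mem_gn k n hij)
        rw [add_lie, smul_lie, bracket_T, smul_zero, zero_add,
          LieRing.of_associative_ring_bracket, sub_eq_zero] at h
        exact h.symm
      subst hy0
      simpa using ht
    · intro hx
      obtain ⟨c, rfl⟩ := Submodule.mem_span_singleton.1 hx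
      refine ⟨(gn k n).smul_mem c (T_mem k n), fun y _ => ?_⟩
      rw [smul_lie, bracket_T, smul_zero]
  · exact sup_le (Submodule.span_le.2 (by simpa using T_mem k n)) (der_le k n)
  · rw [eq_bot_iff]
    rintro x ⟨hx, hd⟩
    obtain ⟨c, rfl⟩ := Submodule.mem_span_singleton.1 hx
    refine (Submodule.mem_bot k).2 (central_der k n _ hd (fun g => ?_))
    rw [mul_smul_comm, smul_mul_assoc, T_central]
end

section
/- Let λ be a symmetric partition (λ = λ') with diagonal length b = b(λ). Then any symmetric partition μ with μ ↗ λ satisfies μ = λ^{(b)} and b(μ) = b − 1 (i.e. μ is obtained from λ by removing the diagonal corner cell (b,b)); in particular there is at most one symmetric μ with μ ↗ λ, and such a μ exists if and only if λ_b = b. -/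
/-- A partition: a weakly decreasing sequence of naturals, almost all zero.
`l i` is the length of row `i + 1` (rows are 0-indexed, so `l i = λ_{i+1}`). -/
def IsPart (l : ℕ → ℕ) : Prop :=
  (∀ i, l (i + 1) ≤ l i) ∧ ∃ N, ∀ i, N ≤ i → l i = 0

/-- The set of cells `(row, column)` (0-indexed) of the Young diagram of `l`. -/
def pcells (l : ℕ → ℕ) : Set (ℕ × ℕ) := {p | p.2 < l p.1}

/-- The size `|λ|` of the partition (number of cells of its Young diagram). -/
noncomputable def psize (l : ℕ → ℕ) : ℕ := Nat.card (pcells l)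

/-- The conjugate (transposed) partition `λ'`: `pconj l j = #{i : λ_{i+1} ≥ j+1}`. -/
noncomputable def pconj (l : ℕ → ℕ) : ℕ → ℕ := fun j => Nat.card {i : ℕ | j < l i}

/-- `μ ↗ λ` : `μ_i ≤ λ_i` for all `i` and `|μ| = |λ| - 1`. -/
def PCovers (m l : ℕ → ℕ) : Prop := (∀ i, m i ≤ l i) ∧ psize m + 1 = psize l

/-- `b(λ)`, the length of the diagonal of `λ` (number of `i ≥ 1` with `λ_i ≥ i`). -/
noncomputable def pdiag (l : ℕ → ℕ) : ℕ := Nat.card {i : ℕ | i < l i}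

/-- `δ(λ)`, the number of descents (removable corners) of `λ`. -/
noncomputable def pdelta (l : ℕ → ℕ) : ℕ := Nat.card {r : ℕ | l (r + 1) < l r}

/-- `λ^{(r)}` for the descent at 0-indexed row `r`: decrease that row by one. -/
def premove (l : ℕ → ℕ) (r : ℕ) : ℕ → ℕ := Function.update l r (l r - 1)

theorem aux_card (S : Set ℕ) (N : ℕ) (hN : ∀ i ∈ S, i < N)
    (hS : ∀ i j, i ≤ j → j ∈ S → i ∈ S) (i : ℕ) : i ∈ S ↔ i < Nat.card S := by
  classical
  have hex : ∃ k, k ∉ S := ⟨N, fun h => lt_irrefl _ (hN N h)⟩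
  have hS2 : S = Set.Iio (Nat.find hex) := by
    ext j
    constructor
    · intro hj
      by_contra hlt
      exact Nat.find_spec hex (hS _ j (by simpa using hlt) hj)
    · intro hj
      by_contra h
      exact Nat.find_min hex hj h
  have hc : Nat.card S = Nat.find hex := by
    conv_lhs => rw [hS2]
    simp
  rw [hc]
  conv_lhs => rw [hS2]
  simp only [Set.mem_Iio]

theorem aux_anti {l : ℕ → ℕ} (hl : IsPart l) {i j : ℕ} (h : i ≤ j) : l j ≤ l i :=
  antitone_nat_of_succ_le hl.1 h

theorem aux_conj {l : ℕ → ℕ} (hl : IsPart l) (i j : ℕ) : j < l i ↔ i < pconj l j := by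
  obtain ⟨N, hN⟩ := hl.2
  refine aux_card {i | j < l i} N ?_ ?_ i
  · intro k hk
    by_contra h
    have := hN k (by omega)
    simp only [Set.mem_setOf_eq] at hk
    omega
  · intro a b hab hb
    exact lt_of_lt_of_le hb (aux_anti hl hab)

theorem aux_diag {l : ℕ → ℕ} (hl : IsPart l) (i : ℕ) : i < l i ↔ i < pdiag l := by
  obtain ⟨N, hN⟩ := hl.2
  refine aux_card {i | i < l i} N ?_ ?_ i
  · intro k hk
    by_contra h
    have := hN k (by omega)
    simp only [Set.mem_setOf_eq] at hk
    omega
  · intro a b hab hb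
    exact lt_of_le_of_lt hab (lt_of_lt_of_le hb (aux_anti hl hab))

theorem aux_sym {l : ℕ → ℕ} (hl : IsPart l) :
    pconj l = l ↔ ∀ i j, j < l i ↔ i < l j := by
  constructor
  · intro h i j
    rw [aux_conj hl, h]
  · intro h
    funext j
    apply eq_of_forall_lt_iff
    intro i
    rw [← aux_conj hl, h]

theorem aux_fin {l : ℕ → ℕ} (hl : IsPart l) : (pcells l).Finite := by
  obtain ⟨N, hN⟩ := hl.2
  refine ((Set.finite_Iio N).prod (Set.finite_Iio (l 0))).subset ?_
  rintro ⟨i, j⟩ h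
  simp only [pcells, Set.mem_setOf_eq] at h
  refine ⟨?_, lt_of_lt_of_le h (aux_anti hl (Nat.zero_le i))⟩
  by_contra hc
  have := hN i (by simpa using hc)
  omega

theorem aux_cover {l m : ℕ → ℕ} (hl : IsPart l) (hsym : pconj l = l) (hm : IsPart m)
    (hms : pconj m = m) (hc : PCovers m l) :
    ∃ r, pdiag l = r + 1 ∧ l r = r + 1 ∧ m = premove l r ∧ pdiag m = r := by
  obtain ⟨hle, hcard⟩ := hc
  rw [aux_sym hl] at hsym
  rw [aux_sym hm] at hms
  have hsub : pcells m ⊆ pcells l := fun p hp => lt_of_lt_of_le hp (hle p.1)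
  have h1 : (pcells l \ pcells m).ncard = 1 := by
    have := Set.ncard_sdiff_add_ncard_of_subset hsub (aux_fin hl)
    simp only [psize, Nat.card_coe_set_eq] at hcard
    omega
  obtain ⟨⟨r, c⟩, hrc⟩ := Set.ncard_eq_one.1 h1
  have key : ∀ i j, (j < l i ∧ ¬ j < m i) ↔ (i = r ∧ j = c) := by
    intro i j
    have := Set.ext_iff.1 hrc (i, j)
    simpa [pcells] using this
  have hcr : c = r := by
    have h := (key r c).2 ⟨rfl, rfl⟩
    rw [hsym, hms] at h
    exact ((key c r).1 h).1
  subst hcr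
  have hne : ∀ i, i ≠ c → m i = l i := by
    intro i hi
    by_contra h
    have := hle i
    exact hi ((key i (m i)).1 ⟨by omega, by omega⟩).1
  have h0 := (key c c).2 ⟨rfl, rfl⟩
  have hmc : m c = c := ((key c (m c)).1 ⟨by omega, by omega⟩).2
  have hlc : l c = c + 1 := by
    have := (key c (l c - 1)).1 ⟨by omega, by omega⟩
    omega
  have hlt := hm.1 c
  rw [hne (c+1) (by omega)] at hlt
  have d1 := aux_diag hl c
  have d2 := aux_diag hl (c+1)
  have d3 := aux_diag hm c
  refine ⟨c, by omega, hlc, ?_, ?_⟩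
  · funext i
    by_cases hi : i = c
    · subst hi; simp [premove]; omega
    · simp [premove, hi, hne i hi]
  · have : c = 0 ∨ c - 1 < pdiag m := by
      rcases Nat.eq_zero_or_pos c with h | h
      · exact Or.inl h
      · right
        rw [← aux_diag hm]
        have := hm.1 (c-1)
        rw [Nat.sub_add_cancel h] at this
        omega
    omega

theorem aux_exists {l : ℕ → ℕ} (hl : IsPart l) (hsym : pconj l = l) (r : ℕ)
    (hr : l r = r + 1) :
    IsPart (premove l r) ∧ pconj (premove l r) = premove l r ∧ PCovers (premove l r) l := by
  rw [aux_sym hl] at hsym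
  have hval : ∀ i, premove l r i = if i = r then r else l i := by
    intro i
    by_cases hi : i = r
    · subst hi; simp [premove, hr]
    · simp [premove, hi]
  have hcell : ∀ i j, j < premove l r i ↔ (j < l i ∧ ¬ (i = r ∧ j = r)) := by
    intro i j
    rw [hval]
    split_ifs with h
    · subst h; omega
    · simp [h]
  have hle : ∀ i, premove l r i ≤ l i := by
    intro i; rw [hval]; split_ifs with h
    · subst h; omega
    · exact le_rfl
  have hp : IsPart (premove l r) := by
    constructor
    · intro i
      by_cases hi : i = r
      · subst hi
        have := hsym (i+1) i
        rw [hval, hval]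
        simp
        omega
      · rw [hval i, if_neg hi]
        exact (hle _).trans (hl.1 i)
    · obtain ⟨N, hN⟩ := hl.2
      exact ⟨N, fun i hi => by have := hN i hi; have := hle i; omega⟩
  refine ⟨hp, ?_, hle, ?_⟩
  · rw [aux_sym hp]
    intro i j
    rw [hcell, hcell, hsym, and_comm (a := i = r)]
  · have : pcells (premove l r) = pcells l \ {(r, r)} := by
      ext ⟨i, j⟩
      have := hcell i j
      simpa [pcells] using this
    rw [psize, psize, this, Nat.card_coe_set_eq, Nat.card_coe_set_eq]
    refine Set.ncard_sdiff_singleton_add_one ?_ (aux_fin hl)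
    simp [pcells, hr]

/-- Let `λ` be a symmetric partition with diagonal length `b = b(λ)`.  Any symmetric
partition `μ` with `μ ↗ λ` satisfies `μ = λ^{(b)}` (removal of the diagonal corner
cell `(b,b)`; here `b` is 1-indexed, so the removal happens at 0-indexed row `b-1`)
and `b(μ) = b - 1`; in particular there is at most one such `μ`, and such a `μ`
exists if and only if `λ_b = b` (which presupposes `b ≥ 1`). -/
theorem symmetric_cover (l : ℕ → ℕ) (hl : IsPart l) (hsym : pconj l = l) :
    (∀ m : ℕ → ℕ, IsPart m → pconj m = m → PCovers m l →
      m = premove l (pdiag l - 1) ∧ pdiag m = pdiag l - 1) ∧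
    ((∃ m : ℕ → ℕ, IsPart m ∧ pconj m = m ∧ PCovers m l) ↔
      (pdiag l ≠ 0 ∧ l (pdiag l - 1) = pdiag l)) := by
  refine ⟨?_, ?_, ?_⟩
  · intro m hm hms hc
    obtain ⟨r, h1, -, h3, h4⟩ := aux_cover hl hsym hm hms hc
    rw [h1, h4]
    exact ⟨h3, rfl⟩
  · rintro ⟨m, hm, hms, hc⟩
    obtain ⟨r, h1, h2, -, -⟩ := aux_cover hl hsym hm hms hc
    rw [h1]
    exact ⟨by omega, h2⟩
  · rintro ⟨h0, h⟩
    exact ⟨_, aux_exists hl hsym (pdiag l - 1) (by omega)⟩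
end

section
/- If λ and μ are partitions with λ ≠ λ', μ ≠ μ', and μ ↗ λ, then it is not the case that μ' ↗ λ. -/
theorem lt_pconj_iff (l : ℕ → ℕ) (hl : IsPart l) (i j : ℕ) : i < pconj l j ↔ j < l i := by
  have ha : Antitone l := antitone_nat_of_succ_le hl.1
  obtain ⟨N, hN⟩ := hl.2
  have hex : ∃ k, ¬ j < l k := ⟨N, by simp [hN N le_rfl]⟩
  classical
  have hs : {i : ℕ | j < l i} = Set.Iio (Nat.find hex) := by
    ext a
    simp only [Set.mem_ofPred_eq, Set.mem_Iio, Nat.lt_find_iff, not_not]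
    exact ⟨fun h b hb => lt_of_lt_of_le h (ha hb), fun h => h a le_rfl⟩
  have hc : pconj l j = Nat.find hex := by
    unfold pconj
    rw [hs]
    simp
  rw [hc]
  have : i ∈ {i : ℕ | j < l i} ↔ i ∈ Set.Iio (Nat.find hex) := by rw [hs]
  exact this.symm

theorem pconj_eq_of_symm (l : ℕ → ℕ) (hl : IsPart l) (h : ∀ i j, j < l i → i < l j) :
    pconj l = l := by
  funext j
  refine eq_of_forall_lt_iff fun i => ?_
  rw [lt_pconj_iff l hl]
  exact ⟨h i j, h j i⟩

/-- If `λ` and `μ` are partitions with `λ ≠ λ'`, `μ ≠ μ'` and `μ ↗ λ`, then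
it is not the case that `μ' ↗ λ`. -/
theorem conj_not_cover (l m : ℕ → ℕ) (hl : IsPart l) (hm : IsPart m)
    (hlsym : pconj l ≠ l) (hmsym : pconj m ≠ m) (hc : PCovers m l) :
    ¬ PCovers (pconj m) l := by
  intro hc'
  obtain ⟨h1, h2⟩ := hc
  obtain ⟨h3, -⟩ := hc'
  have h2' : (pcells m).ncard + 1 = (pcells l).ncard := h2
  have hfin : (pcells l).Finite := Set.finite_of_ncard_ne_zero (by omega)
  have hU : pcells m ∪ pcells (pconj m) ⊆ pcells l := by
    rintro ⟨a, b⟩ (h | h)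
    · exact lt_of_lt_of_le h (h1 a)
    · exact lt_of_lt_of_le h (h3 a)
  have hss : pcells m ⊂ pcells m ∪ pcells (pconj m) := by
    refine ⟨Set.subset_union_left, fun hsub => hmsym ?_⟩
    apply pconj_eq_of_symm m hm
    intro i j hij
    exact hsub (a := (j, i)) (Or.inr ((lt_pconj_iff m hm i j).2 hij))
  have hlt := Set.ncard_lt_ncard hss (hfin.subset hU)
  have heq := Set.eq_of_subset_of_ncard_le hU (by omega) hfin
  apply hlsym
  apply pconj_eq_of_symm l hl
  intro i j hij
  have hmem : (i, j) ∈ pcells m ∪ pcells (pconj m) := by rw [heq]; exact hij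
  have : (j, i) ∈ pcells m ∪ pcells (pconj m) := by
    rcases hmem with h | h
    · exact Or.inr ((lt_pconj_iff m hm i j).2 h)
    · exact Or.inl ((lt_pconj_iff m hm j i).1 h)
  rw [heq] at this
  exact this
end

section
/- If λ = λ' is a symmetric partition of n, then the number of shifts ν(λ) is congruent to (n − b(λ))/2 modulo 2 (note that n − b(λ) is even for symmetric λ). -/
/-- `ν(λ)`, the number of shifts (décalages) of `λ`: pairs of cells
`((i₁,j₁),(i₂,j₂))` of `λ` with `i₁ < i₂` and `j₁ > j₂`. -/
noncomputable def pshifts (l : ℕ → ℕ) : ℕ :=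
  Nat.card {pq : (ℕ × ℕ) × (ℕ × ℕ) | pq.1 ∈ pcells l ∧ pq.2 ∈ pcells l ∧
    pq.1.1 < pq.2.1 ∧ pq.2.2 < pq.1.2}

theorem sm_symm (l : ℕ → ℕ) (hl : IsPart l) (hsym : pconj l = l) (i j : ℕ) :
    j < l i ↔ i < l j := by
  obtain ⟨hd, N, hN⟩ := hl
  have anti : Antitone l := antitone_nat_of_succ_le hd
  have hex : ∃ i, l i ≤ j := ⟨N, by simp [hN N le_rfl]⟩
  have key : ∀ i, j < l i ↔ i < Nat.find hex := by
    intro i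
    rw [Nat.lt_find_iff]
    constructor
    · intro h m hm hle
      have := anti hm
      omega
    · intro h
      have := h i le_rfl
      omega
  have hc : l j = Nat.find hex := by
    have h1 : pconj l j = Nat.find hex := by
      have h2 : {i : ℕ | j < l i} = Set.Iio (Nat.find hex) := by
        ext i; exact key i
      unfold pconj
      rw [h2]; simp
    rw [← h1, hsym]
  rw [key, hc]

/-- If `λ = λ'` is a symmetric partition of `n`, then `n - b(λ)` is even and the
number of shifts `ν(λ)` is congruent to `(n - b(λ))/2` modulo 2. -/
theorem shifts_mod_two (n : ℕ) (l : ℕ → ℕ) (hl : IsPart l) (hsym : pconj l = l)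
    (hn : psize l = n) :
    (n - pdiag l) % 2 = 0 ∧ pshifts l ≡ (n - pdiag l) / 2 [MOD 2] := by
  classical
  have hs := sm_symm l hl hsym
  obtain ⟨hd, N, hN⟩ := hl
  have anti : Antitone l := antitone_nat_of_succ_le hd
  have hfin : (pcells l).Finite := by
    apply ((Set.finite_Iio N).prod (Set.finite_Iio (l 0))).subset
    rintro ⟨i, j⟩ h
    have h : j < l i := h
    refine ⟨?_, lt_of_lt_of_le h (anti (Nat.zero_le i))⟩
    by_contra hc
    have hc : ¬ i < N := hc
    have := hN i (by omega)
    omega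
  set U : Set (ℕ × ℕ) := {p | p ∈ pcells l ∧ p.1 < p.2} with hU
  set L : Set (ℕ × ℕ) := {p | p ∈ pcells l ∧ p.2 < p.1} with hL
  set D : Set (ℕ × ℕ) := {p | p ∈ pcells l ∧ p.1 = p.2} with hD
  have fU : U.Finite := hfin.subset fun p h => h.1
  have fL : L.Finite := hfin.subset fun p h => h.1
  have fD : D.Finite := hfin.subset fun p h => h.1
  have cL : L.ncard = U.ncard := by
    have : L = Prod.swap '' U := by
      ext ⟨i, j⟩
      simp only [hU, hL, pcells, Set.mem_setOf_eq, Set.mem_image, Prod.exists, Prod.swap_prod_mk,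
        Prod.mk.injEq]
      constructor
      · rintro ⟨h1, h2⟩
        exact ⟨j, i, ⟨(hs _ _).1 h1, h2⟩, rfl, rfl⟩
      · rintro ⟨a, b, ⟨h1, h2⟩, rfl, rfl⟩
        exact ⟨(hs _ _).1 h1, h2⟩
    rw [this, Set.ncard_image_of_injective _ Prod.swap_injective]
  have cD : D.ncard = pdiag l := by
    have : D = (fun i : ℕ => (i, i)) '' {i : ℕ | i < l i} := by
      ext ⟨i, j⟩
      simp only [hD, pcells, Set.mem_setOf_eq, Set.mem_image, Prod.mk.injEq]
      constructor
      · rintro ⟨h1, rfl⟩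
        exact ⟨i, h1, rfl, rfl⟩
      · rintro ⟨a, h1, rfl, rfl⟩
        exact ⟨h1, rfl⟩
    rw [this, Set.ncard_image_of_injective _ (fun a b h => (Prod.mk.inj h).1)]
    rfl
  have ctot : n = D.ncard + (U.ncard + L.ncard) := by
    have h1 : pcells l = D ∪ (U ∪ L) := by
      ext p
      simp only [hD, hU, hL, Set.mem_union, Set.mem_setOf_eq]
      have := lt_trichotomy p.1 p.2
      tauto
    have hUL : Disjoint U L := by
      rw [Set.disjoint_left]
      intro p h h'
      exact absurd h.2 (not_lt.2 h'.2.le)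
    have hDUL : Disjoint D (U ∪ L) := by
      rw [Set.disjoint_left]
      rintro p h (h' | h')
      · exact absurd h.2 h'.2.ne
      · exact absurd h.2 h'.2.ne'
    rw [← hn, ← Set.ncard_union_eq hUL fU fL, ← Set.ncard_union_eq hDUL fD (fU.union fL), ← h1]
    rfl
  have hdiff : n - pdiag l = 2 * U.ncard := by omega
  refine ⟨by omega, ?_⟩
  have hdiv : (n - pdiag l) / 2 = U.ncard := by omega
  rw [hdiv]
  set S : Set ((ℕ × ℕ) × (ℕ × ℕ)) := {pq | pq.1 ∈ pcells l ∧ pq.2 ∈ pcells l ∧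
    pq.1.1 < pq.2.1 ∧ pq.2.2 < pq.1.2} with hS
  have fS : S.Finite := (hfin.prod hfin).subset fun p h => ⟨h.1, h.2.1⟩
  haveI : Fintype S := fS.fintype
  haveI : Fact (Nat.Prime 2) := ⟨Nat.prime_two⟩
  let f : Function.End S := fun x => ⟨(x.1.2.swap, x.1.1.swap),
    (hs _ _).1 x.2.2.1, (hs _ _).1 x.2.1, x.2.2.2.2, x.2.2.2.1⟩
  have hf : f ^ 2 ^ 1 = 1 := by
    rw [pow_one, pow_two]
    rfl
  have hmod := Equiv.Perm.card_fixedPoints_modEq hf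
  have e1 : pshifts l = Fintype.card S := by
    rw [← Nat.card_eq_fintype_card]; rfl
  have e2 : Fintype.card (Function.fixedPoints f) = U.ncard := by
    rw [← Nat.card_eq_fintype_card]
    change _ = Nat.card U
    refine Nat.card_congr ⟨fun x => ⟨x.1.1.1, x.1.2.1, ?_⟩, fun p => ⟨⟨(p.1, p.1.swap), p.2.1, (hs _ _).1 p.2.1, p.2.2, p.2.2⟩, rfl⟩, ?_, ?_⟩
    · obtain ⟨⟨⟨⟨a, b⟩, ⟨c, d⟩⟩, h⟩, hx⟩ := x
      have h1 := congrArg Subtype.val hx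
      simp only [f, Prod.swap_prod_mk, Prod.mk.injEq] at h1
      have h2 : a < c := h.2.2.1
      change a < b
      omega
    · rintro ⟨⟨⟨⟨a, b⟩, ⟨c, d⟩⟩, h⟩, hx⟩
      have h1 := congrArg Subtype.val hx
      simp only [f, Prod.swap_prod_mk, Prod.mk.injEq] at h1
      apply Subtype.ext
      apply Subtype.ext
      obtain ⟨⟨h2, h3⟩, h4, h5⟩ := h1
      change ((a, b), (b, a)) = ((a, b), (c, d))
      rw [h4, h5]
    · intro p
      rfl
  rw [e1, ← e2]
  exact hmod
end

section
/- For all natural numbers a, b ≥ 0, the number of standard Young tableaux of the shape D(a,b) = [a+2, 2, 1^b] (a partition of n = a+b+4) satisfies (a+2)·f([a+2,2,1^b]) = (b+1)·(a+b+4)·C(a+b+2, a), where C(·,·) is the binomial coefficient. -/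
/-- `T` is a standard Young tableau of shape `l`: a bijective labelling of the cells
by `1, …, n` which is strictly increasing along each row and each column
(and `0` outside the diagram, to pin the function down). -/
def IsSYT (l : ℕ → ℕ) (T : ℕ × ℕ → ℕ) : Prop :=
  Set.BijOn T (pcells l) (Set.Icc 1 (psize l)) ∧
  (∀ p ∈ pcells l, ∀ q ∈ pcells l, p.1 = q.1 → p.2 < q.2 → T p < T q) ∧
  (∀ p ∈ pcells l, ∀ q ∈ pcells l, p.2 = q.2 → p.1 < q.1 → T p < T q) ∧
  (∀ p, p ∉ pcells l → T p = 0)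

/-- `f(λ)`, the number of standard Young tableaux of shape `l`. -/
noncomputable def sytCount (l : ℕ → ℕ) : ℕ := Nat.card {T : ℕ × ℕ → ℕ // IsSYT l T}

/-- The partition `D(a,b) = [a+2, 2, 1^b]` (0-indexed rows). -/
def dab (a b : ℕ) : ℕ → ℕ := fun i =>
  if i = 0 then a + 2 else if i = 1 then 2 else if i < b + 2 then 1 else 0

/-- The hook partition `[c, 1^r]` (0-indexed rows). -/
def hookp (c r : ℕ) : ℕ → ℕ := fun i => if i = 0 then c else if i < r + 1 then 1 else 0

theorem cells_premove {l : ℕ → ℕ} {r : ℕ} :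
    pcells (premove l r) = pcells l \ {(r, l r - 1)} := by
  ext ⟨i, j⟩
  simp only [pcells, premove, Set.mem_ofPred_eq, Set.mem_sdiff, Set.mem_singleton_iff, Prod.mk.injEq]
  by_cases hi : i = r
  · subst hi
    simp
    omega
  · simp [hi]

theorem cells_finite {l : ℕ → ℕ} (h : IsPart l) : (pcells l).Finite := by
  obtain ⟨h1, N, hN⟩ := h
  have ha : Antitone l := antitone_nat_of_succ_le h1
  apply ((Set.finite_Iio N).prod (Set.finite_Iio (l 0))).subset
  rintro ⟨i, j⟩ hij
  simp only [pcells, Set.mem_ofPred_eq] at hij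
  simp only [Set.mem_prod, Set.mem_Iio]
  constructor
  · by_contra hc
    have := hN i (by omega)
    omega
  · exact lt_of_lt_of_le hij (ha (Nat.zero_le i))

theorem psize_premove {l : ℕ → ℕ} {r : ℕ} (h : IsPart l) (hr : l (r + 1) < l r) :
    psize (premove l r) + 1 = psize l := by
  unfold psize
  rw [cells_premove, Nat.card_coe_set_eq, Nat.card_coe_set_eq]
  apply Set.ncard_sdiff_singleton_add_one _ (cells_finite h)
  simp only [pcells, Set.mem_ofPred_eq]
  omega

theorem isPart_premove {l : ℕ → ℕ} {r : ℕ} (h : IsPart l) (hr : l (r + 1) < l r) :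
    IsPart (premove l r) := by
  obtain ⟨h1, N, hN⟩ := h
  refine ⟨fun i => ?_, N, fun i hi => ?_⟩
  · have := h1 i
    simp only [premove, Function.update_apply]
    split_ifs <;> subst_vars <;> omega
  · have := hN i hi
    simp only [premove, Function.update_apply]
    split_ifs <;> subst_vars <;> omega

theorem syt_finite {l : ℕ → ℕ} (h : IsPart l) : Finite {T : ℕ × ℕ → ℕ // IsSYT l T} := by
  have := (cells_finite h).to_subtype
  let F : {T : ℕ × ℕ → ℕ // IsSYT l T} → (pcells l → Set.Icc 1 (psize l)) :=
    fun T p => ⟨T.1 p.1, T.2.1.mapsTo p.2⟩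
  apply Finite.of_injective F
  rintro ⟨T, hT⟩ ⟨U, hU⟩ hTU
  apply Subtype.ext
  funext p
  by_cases hp : p ∈ pcells l
  · have := congrArg Subtype.val (congrFun hTU ⟨p, hp⟩)
    exact this
  · exact (hT.2.2.2 p hp).trans (hU.2.2.2 p hp).symm

theorem syt_extend {l : ℕ → ℕ} {r : ℕ} (h : IsPart l) (hr : l (r + 1) < l r)
    {T : ℕ × ℕ → ℕ} (hT : IsSYT (premove l r) T) :
    IsSYT l (Function.update T (r, l r - 1) (psize l)) := by
  have hs := psize_premove h hr
  have ha : Antitone l := antitone_nat_of_succ_le h.1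
  have hc : (r, l r - 1) ∈ pcells l := by
    simp only [pcells, Set.mem_ofPred_eq]; omega
  obtain ⟨hb, hrow, hcol, hz⟩ := hT
  rw [cells_premove] at hb hrow hcol hz
  have hlt : ∀ p ∈ pcells l, p ≠ (r, l r - 1) → 1 ≤ T p ∧ T p < psize l := by
    intro p hp hne
    have := hb.mapsTo (show p ∈ pcells l \ {(r, l r - 1)} from ⟨hp, hne⟩)
    simp only [Set.mem_Icc] at this
    omega
  refine ⟨⟨?_, ?_, ?_⟩, ?_, ?_, ?_⟩
  · intro p hp
    by_cases hpc : p = (r, l r - 1)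
    · subst hpc; simp; omega
    · have := hlt p hp hpc
      simp [hpc]; omega
  · intro p hp q hq hpq
    by_cases hpc : p = (r, l r - 1) <;> by_cases hqc : q = (r, l r - 1)
    · rw [hpc, hqc]
    · have := hlt q hq hqc
      simp [hpc, hqc] at hpq; omega
    · have := hlt p hp hpc
      simp [hpc, hqc] at hpq; omega
    · simp [hpc, hqc] at hpq
      exact hb.injOn ⟨hp, hpc⟩ ⟨hq, hqc⟩ hpq
  · intro k hk
    by_cases hkn : k = psize l
    · exact ⟨_, hc, by simp [hkn]⟩
    · obtain ⟨p, hp, hpk⟩ := hb.surjOn (show k ∈ Set.Icc 1 (psize (premove l r)) by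
        simp only [Set.mem_Icc] at hk ⊢; omega)
      exact ⟨p, hp.1, by rw [Function.update_of_ne hp.2]; exact hpk⟩
  · intro p hp q hq h1 h2
    have hpc : p ≠ (r, l r - 1) := by
      rintro rfl
      simp only [pcells, Set.mem_ofPred_eq] at hq h1 h2
      rw [← h1] at hq; omega
    by_cases hqc : q = (r, l r - 1)
    · have := hlt p hp hpc
      simp [hpc, hqc]; omega
    · simp only [Function.update_of_ne hpc, Function.update_of_ne hqc]
      exact hrow p ⟨hp, hpc⟩ q ⟨hq, hqc⟩ h1 h2
  · intro p hp q hq h1 h2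
    have hpc : p ≠ (r, l r - 1) := by
      rintro rfl
      simp only [pcells, Set.mem_ofPred_eq] at hq h1 h2
      have := ha (show r + 1 ≤ q.1 from h2)
      omega
    by_cases hqc : q = (r, l r - 1)
    · have := hlt p hp hpc
      simp [hpc, hqc]; omega
    · simp only [Function.update_of_ne hpc, Function.update_of_ne hqc]
      exact hcol p ⟨hp, hpc⟩ q ⟨hq, hqc⟩ h1 h2
  · intro p hp
    have hpc : p ≠ (r, l r - 1) := by
      rintro rfl; exact hp hc
    rw [Function.update_of_ne hpc]
    exact hz p (fun hh => hp hh.1)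

theorem syt_restrict {l : ℕ → ℕ} {r : ℕ} (h : IsPart l) (hr : l (r + 1) < l r)
    {T : ℕ × ℕ → ℕ} (hT : IsSYT l T) (hn : T (r, l r - 1) = psize l) :
    IsSYT (premove l r) (Function.update T (r, l r - 1) 0) := by
  have hs := psize_premove h hr
  have hc : (r, l r - 1) ∈ pcells l := by
    simp only [pcells, Set.mem_ofPred_eq]; omega
  obtain ⟨hb, hrow, hcol, hz⟩ := hT
  unfold IsSYT
  rw [cells_premove]
  refine ⟨⟨?_, ?_, ?_⟩, ?_, ?_, ?_⟩
  · rintro p ⟨hp, hpc⟩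
    rw [Function.update_of_ne hpc]
    have h1 := hb.mapsTo hp
    have h2 : T p ≠ psize l := fun he => hpc (hb.injOn hp hc (he.trans hn.symm))
    simp only [Set.mem_Icc] at h1 ⊢
    omega
  · rintro p ⟨hp, hpc⟩ q ⟨hq, hqc⟩ hpq
    rw [Function.update_of_ne hpc, Function.update_of_ne hqc] at hpq
    exact hb.injOn hp hq hpq
  · intro k hk
    simp only [Set.mem_Icc] at hk
    obtain ⟨p, hp, hpk⟩ := hb.surjOn (show k ∈ Set.Icc 1 (psize l) by
        simp only [Set.mem_Icc]; omega)
    have hpc : p ≠ (r, l r - 1) := by rintro rfl; omega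
    exact ⟨p, ⟨hp, hpc⟩, by rw [Function.update_of_ne hpc]; exact hpk⟩
  · rintro p ⟨hp, hpc⟩ q ⟨hq, hqc⟩ h1 h2
    rw [Function.update_of_ne hpc, Function.update_of_ne hqc]
    exact hrow p hp q hq h1 h2
  · rintro p ⟨hp, hpc⟩ q ⟨hq, hqc⟩ h1 h2
    rw [Function.update_of_ne hpc, Function.update_of_ne hqc]
    exact hcol p hp q hq h1 h2
  · intro p hp
    by_cases hpc : p = (r, l r - 1)
    · simp [hpc]
    · rw [Function.update_of_ne hpc]
      exact hz p (fun hh => hp ⟨hh, hpc⟩)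

theorem syt_lt {l : ℕ → ℕ} {r : ℕ} (h : IsPart l) (hr : l (r + 1) < l r)
    {T : ℕ × ℕ → ℕ} (hT : IsSYT (premove l r) T) (p : ℕ × ℕ) : T p < psize l := by
  have hs := psize_premove h hr
  by_cases hp : p ∈ pcells (premove l r)
  · have := hT.1.mapsTo hp
    simp only [Set.mem_Icc] at this; omega
  · rw [hT.2.2.2 p hp]; omega

theorem branching {l : ℕ → ℕ} (h : IsPart l) (S : Finset ℕ) (hS : ∀ r, r ∈ S ↔ l (r + 1) < l r)
    (hne : 0 < l 0) :
    sytCount l = ∑ r ∈ S, sytCount (premove l r) := by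
  let F : (Σ r : S, {T : ℕ × ℕ → ℕ // IsSYT (premove l r) T}) → {T : ℕ × ℕ → ℕ // IsSYT l T} :=
    fun x => ⟨Function.update x.2.1 (x.1.1, l x.1.1 - 1) (psize l),
      syt_extend h ((hS _).1 x.1.2) x.2.2⟩
  have hF : Function.Bijective F := by
    constructor
    · rintro ⟨⟨r, hr⟩, T, hT⟩ ⟨⟨s, hs⟩, U, hU⟩ he
      have he := congrArg Subtype.val he
      simp only [F] at he hT hU
      have hrs : r = s := by
        by_contra hrs
        have := congrFun he (r, l r - 1)
        rw [Function.update_self, Function.update_of_ne (by simp [hrs])] at this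
        have := syt_lt h ((hS _).1 hs) hU (r, l r - 1)
        omega
      subst hrs
      have : T = U := by
        funext p
        by_cases hp : p = (r, l r - 1)
        · subst hp
          have hnc : (r, l r - 1) ∉ pcells (premove l r) := by
            rw [cells_premove]; simp
          exact (hT.2.2.2 _ hnc).trans (hU.2.2.2 _ hnc).symm
        · have := congrFun he p
          rwa [Function.update_of_ne hp, Function.update_of_ne hp] at this
      subst this
      rfl
    · rintro ⟨T, hT⟩
      have hpos : 0 < psize l := by
        unfold psize
        have := (cells_finite h).to_subtype
        have : Nonempty (pcells l) := ⟨⟨(0, 0), hne⟩⟩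
        exact Nat.card_pos
      obtain ⟨⟨r, j⟩, hp, hpn⟩ := hT.1.surjOn (show psize l ∈ Set.Icc 1 (psize l) by
        simp only [Set.mem_Icc]; omega)
      have hmax : ∀ q ∈ pcells l, T q ≤ psize l := fun q hq => (hT.1.mapsTo hq).2
      have hj : j < l r := hp
      have h1 : ¬ (j + 1 < l r) := fun hh => by
        have := hT.2.1 (r, j) hp (r, j + 1) hh rfl (by simp)
        have := hmax (r, j + 1) hh
        omega
      have h2 : ¬ (j < l (r + 1)) := fun hh => by
        have := hT.2.2.1 (r, j) hp (r + 1, j) hh rfl (by simp)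
        have := hmax (r + 1, j) hh
        omega
      have hr : l (r + 1) < l r := by omega
      obtain rfl : j = l r - 1 := by omega
      refine ⟨⟨⟨r, (hS r).2 hr⟩, _, syt_restrict h hr hT hpn⟩, ?_⟩
      apply Subtype.ext
      simp only [F]
      rw [Function.update_idem, ← hpn, Function.update_eq_self]
  have hfin : ∀ r : S, Finite {T : ℕ × ℕ → ℕ // IsSYT (premove l r) T} :=
    fun r => syt_finite (isPart_premove h ((hS _).1 r.2))
  unfold sytCount
  rw [← Nat.card_congr (Equiv.ofBijective F hF), Nat.card_sigma,
    ← Finset.sum_coe_sort S (fun r => Nat.card {T : ℕ × ℕ → ℕ // IsSYT (premove l r) T})]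

theorem syt_zero : sytCount (fun _ => 0) = 1 := by
  have hc : pcells (fun _ => 0) = ∅ := by ext p; simp [pcells]
  have hs : psize (fun _ => 0) = 0 := by simp [psize, hc]
  unfold sytCount
  rw [Nat.card_eq_one_iff_unique]
  refine ⟨⟨?_⟩, ⟨⟨fun _ => 0, ?_⟩⟩⟩
  · rintro ⟨T, hT⟩ ⟨U, hU⟩
    apply Subtype.ext
    funext p
    exact (hT.2.2.2 p (by simp [hc])).trans (hU.2.2.2 p (by simp [hc])).symm
  · unfold IsSYT
    simp [hc, hs]

theorem isPart_hook (c r : ℕ) : IsPart (hookp (c + 1) r) := by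
  refine ⟨fun i => ?_, r + 1, fun i hi => ?_⟩ <;> simp only [hookp] <;> grind

theorem isPart_dab (a b : ℕ) : IsPart (dab a b) := by
  refine ⟨fun i => ?_, b + 2, fun i hi => ?_⟩ <;> simp only [dab] <;> grind

theorem hook_count (c r : ℕ) : sytCount (hookp (c + 1) r) = (c + r).choose r := by
  have hpos : ∀ c r, 0 < hookp (c + 1) r 0 := by intro c r; simp [hookp]
  induction c generalizing r with
  | zero =>
    induction r with
    | zero =>
      rw [branching (isPart_hook _ _) {0} ?_ (hpos _ _), Finset.sum_singleton]
      · have : premove (hookp (0 + 1) 0) 0 = fun _ => 0 := by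
          funext i
          simp only [premove, Function.update_apply, hookp]
          grind
        rw [this, syt_zero]; rfl
      · intro i
        simp only [hookp, Finset.mem_singleton]
        grind
    | succ r ih =>
      rw [branching (isPart_hook _ _) {r + 1} ?_ (hpos _ _), Finset.sum_singleton]
      · have : premove (hookp (0 + 1) (r + 1)) (r + 1) = hookp (0 + 1) r := by
          funext i
          simp only [premove, Function.update_apply, hookp]
          grind
        rw [this, ih]; simp
      · intro i
        simp only [hookp, Finset.mem_singleton]
        grind
  | succ c ihc =>
    have h0 : ∀ r, premove (hookp (c + 1 + 1) r) 0 = hookp (c + 1) r := by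
      intro r
      funext i
      simp only [premove, Function.update_apply, hookp]
      grind
    induction r with
    | zero =>
      rw [branching (isPart_hook _ _) {0} ?_ (hpos _ _), Finset.sum_singleton]
      · rw [h0, ihc]; simp
      · intro i
        simp only [hookp, Finset.mem_singleton]
        grind
    | succ r ih =>
      rw [branching (isPart_hook _ _) {0, r + 1} ?_ (hpos _ _), Finset.sum_pair (by omega)]
      · have : premove (hookp (c + 1 + 1) (r + 1)) (r + 1) = hookp (c + 1 + 1) r := by
          funext i
          simp only [premove, Function.update_apply, hookp]
          grind
        rw [h0, this, ih, ihc, show c + 1 + (r + 1) = (c + 1 + r) + 1 by ring,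
          Nat.choose_succ_succ, show c + (r + 1) = c + 1 + r by ring]
        ring
      · intro i
        simp only [hookp, Finset.mem_insert, Finset.mem_singleton]
        grind

theorem dab_row0 (a b : ℕ) : premove (dab (a + 1) b) 0 = dab a b := by
  funext i
  simp only [premove, Function.update_apply, dab]
  grind

theorem dab_row1 (a b : ℕ) : premove (dab a b) 1 = hookp (a + 1 + 1) (b + 1) := by
  funext i
  simp only [premove, Function.update_apply, dab, hookp]
  grind

theorem dab_last (a b : ℕ) : premove (dab a (b + 1)) (b + 2) = dab a b := by
  funext i
  simp only [premove, Function.update_apply, dab]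
  grind

theorem dim_dab (a b : ℕ) :
    (a + 2) * sytCount (dab a b) = (b + 1) * ((a + b + 4) * Nat.choose (a + b + 2) a) := by
  have hpos : ∀ a b, 0 < dab a b 0 := by intro a b; simp [dab]
  induction a generalizing b with
  | zero =>
    induction b with
    | zero =>
      rw [branching (isPart_dab _ _) {1} ?_ (hpos _ _), Finset.sum_singleton]
      · rw [dab_row1, hook_count]; decide
      · intro i
        simp only [dab, Finset.mem_singleton]
        grind
    | succ b ih =>
      rw [branching (isPart_dab _ _) {1, b + 2} ?_ (hpos _ _), Finset.sum_pair (by omega)]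
      · rw [dab_row1, hook_count, dab_last, mul_add, ih,
          show 0 + 1 + (b + 1 + 1) = (b + 2) + 1 by ring, show b + 1 + 1 = b + 2 by ring,
          Nat.choose_succ_self_right]
        simp
        ring
      · intro i
        simp only [dab, Finset.mem_insert, Finset.mem_singleton]
        grind
  | succ a iha =>
    induction b with
    | zero =>
      rw [branching (isPart_dab _ _) {0, 1} ?_ (hpos _ _), Finset.sum_pair (by omega)]
      · rw [dab_row0, dab_row1, hook_count]
        have h1 := iha 0
        have e1 : (a + 0 + 2).choose a * 2 = (a + 2) * (a + 1) := by
          have := Nat.triangle_succ (a + 1)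
          have h2 : (a + 2).choose a = (a + 2).choose 2 := Nat.choose_symm_add
          rw [add_zero, h2, Nat.choose_two_right, Nat.div_mul_cancel]
          · simp
          · exact (Nat.even_mul_pred_self _).two_dvd
        have e2 : (a + 1 + 0 + 2).choose (a + 1) * 2 = (a + 3) * (a + 2) := by
          have h2 : (a + 1 + 2).choose (a + 1) = (a + 1 + 2).choose 2 := Nat.choose_symm_add
          rw [add_zero, h2, Nat.choose_two_right, Nat.div_mul_cancel]
          · simp
          · exact (Nat.even_mul_pred_self _).two_dvd
        simp only [zero_add, Nat.choose_one_right]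
        generalize sytCount (dab a 0) = g at *
        generalize (a + 0 + 2).choose a = x at *
        generalize (a + 1 + 0 + 2).choose (a + 1) = y at *
        qify at *
        have hg : (g : ℚ) = (a + 4) * (a + 1) / 2 := by
          have h3 : (a + 2 : ℚ) ≠ 0 := by positivity
          apply mul_left_cancel₀ h3
          linear_combination h1 + (a + 4) / 2 * e1
        rw [hg]
        linear_combination -(a + 5 : ℚ) / 2 * e2
      · intro i
        simp only [dab, Finset.mem_insert, Finset.mem_singleton]
        grind
    | succ b ih =>
      rw [branching (isPart_dab _ _) {0, 1, b + 2} ?_ (hpos _ _),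
        Finset.sum_insert (by simp), Finset.sum_pair (by omega)]
      · rw [dab_row0, dab_row1, dab_last, hook_count]
        have h1 := iha (b + 1)
        have e1 := Nat.choose_succ_right_eq (a + b + 3) a
        have e2 := Nat.choose_succ_right_eq (a + b + 3) (a + 1)
        rw [show a + b + 3 - a = b + 3 by omega] at e1
        rw [show a + b + 3 - (a + 1) = b + 2 by omega] at e2
        have p1 : (a + 1 + (b + 1) + 2).choose (a + 1) =
            (a + b + 3).choose a + (a + b + 3).choose (a + 1) := by
          rw [show a + 1 + (b + 1) + 2 = (a + b + 3) + 1 by ring, Nat.choose_succ_succ]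
        have p2 : (a + 1 + 1 + (b + 1 + 1)).choose (b + 1 + 1) =
            (a + b + 3).choose (a + 1) + (a + b + 3).choose (a + 1 + 1) := by
          rw [← Nat.choose_symm_add, show a + 1 + 1 + (b + 1 + 1) = (a + b + 3) + 1 by ring,
            Nat.choose_succ_succ]
        rw [p1, p2]
        rw [show a + (b + 1) + 2 = a + b + 3 by ring] at h1
        rw [show a + 1 + b + 2 = a + b + 3 by ring] at ih
        generalize sytCount (dab a (b + 1)) = g at *
        generalize sytCount (dab (a + 1) b) = k at *
        generalize (a + b + 3).choose (a + 1 + 1) = z at *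
        generalize (a + b + 3).choose (a + 1) = x at *
        generalize (a + b + 3).choose a = y at *
        clear p1 p2
        qify at *
        have q1 : (a + 1 : ℚ) ≠ 0 := by positivity
        have q2 : (a + 2 : ℚ) ≠ 0 := by positivity
        have q3 : (a + 3 : ℚ) ≠ 0 := by positivity
        have hx : (x : ℚ) = y * (b + 3) / (a + 1) := by
          field_simp; linear_combination e1
        have hz : (z : ℚ) = x * (b + 2) / (a + 2) := by
          field_simp; linear_combination e2
        have hg : (g : ℚ) = (b + 2) * (a + b + 5) * y / (a + 2) := by
          field_simp; linear_combination h1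
        have hk : (k : ℚ) = (b + 1) * (a + b + 5) * x / (a + 3) := by
          field_simp; linear_combination ih
        rw [hg, hk, hz, hx]
        field_simp
        ring
      · intro i
        simp only [dab, Finset.mem_insert, Finset.mem_singleton]
        grind
end

section
/- The following binomial inequalities hold: (1) for every m ≥ 3, 2·(m−1)·(m+1)·C(2m, m) > (m+2)·C(2m+1, m); (2) for every a ≥ 2, 4·(2a+3)·C(2a+1, a−1) > 2·(a+1)·C(2a+2, a); (3) for all a, b with a > b+1 ≥ 3, (b+1)·(a+b+4)·C(a+b+2, a) > 3·(a+2)·C(a+b+2, b+1). (These express respectively dim D(m,m−2) > C(2m+1,m), dim D(a−1,a) > (1/4)·dim D(a,a), and dim D(a,b) > 3·C(a+b+2, b+1), where dim D(a,b) = ((b+1)/(a+2))·C(a+b+2,a)·(a+b+4).) -/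
/-- Binomial inequalities: (1) for `m ≥ 3`, `2(m-1)(m+1)·C(2m,m) > (m+2)·C(2m+1,m)`
(i.e. `(m+2)·dim D(m,m-2) > (m+2)·C(2m+1,m)` after clearing denominators);
(2) for `a ≥ 2`, `4·(2a+3)·C(2a+1,a-1) > 2(a+1)·C(2a+2,a)`
(i.e. `dim D(a-1,a) > (1/4)·dim D(a,a)`);
(3) for `a > b+1 ≥ 3`, `(b+1)·(a+b+4)·C(a+b+2,a) > 3·(a+2)·C(a+b+2,b+1)`
(i.e. `dim D(a,b) > 3·C(a+b+2,b+1)`). -/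
theorem binomial_inequalities :
    (∀ m : ℕ, 3 ≤ m →
      (m + 2) * Nat.choose (2 * m + 1) m < 2 * (m - 1) * (m + 1) * Nat.choose (2 * m) m) ∧
    (∀ a : ℕ, 2 ≤ a →
      2 * (a + 1) * Nat.choose (2 * a + 2) a < 4 * ((2 * a + 3) * Nat.choose (2 * a + 1) (a - 1))) ∧
    (∀ a b : ℕ, 3 ≤ b + 1 → b + 1 < a →
      3 * ((a + 2) * Nat.choose (a + b + 2) (b + 1)) <
        (b + 1) * ((a + b + 4) * Nat.choose (a + b + 2) a)) := by
  refine ⟨?_, ?_, ?_⟩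
  · intro m hm
    obtain ⟨k, rfl⟩ : ∃ k, m = k + 3 := ⟨m - 3, by omega⟩
    have h1 := Nat.add_one_mul_choose_eq (2 * (k + 3)) (k + 3)
    have h2 : Nat.choose (2 * (k + 3) + 1) (k + 3) = Nat.choose (2 * (k + 3) + 1) (k + 3 + 1) :=
      Nat.choose_symm_of_eq_add (by omega)
    have hp : 0 < Nat.choose (2 * (k + 3)) (k + 3) := Nat.choose_pos (by omega)
    skip
    rw [← h2] at h1
    have e : k + 3 - 1 = k + 2 := by omega
    rw [e]
    generalize Nat.choose (2 * (k + 3) + 1) (k + 3) = X at *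
    generalize Nat.choose (2 * (k + 3)) (k + 3) = Y at *
    apply lt_of_mul_lt_mul_right (a := k + 3 + 1) _ (by omega)
    calc (k + 3 + 2) * X * (k + 3 + 1) = (k + 5) * (2 * (k + 3) + 1) * Y := by
          nlinarith [h1]
      _ < (2 * (k + 2) * (k + 3 + 1) * (k + 3 + 1)) * Y := by
          apply Nat.mul_lt_mul_of_pos_right _ hp
          ring_nf
          nlinarith [Nat.zero_le (k^3), Nat.zero_le (k^2)]
      _ = _ := by ring
  · intro a ha
    obtain ⟨c, rfl⟩ : ∃ c, a = c + 1 := ⟨a - 1, by omega⟩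
    have h1 := Nat.add_one_mul_choose_eq (2 * (c + 1) + 1) c
    have hp : 0 < Nat.choose (2 * (c + 1) + 1) c := Nat.choose_pos (by omega)
    simp only [Nat.succ_eq_add_one, add_assoc, Nat.reduceAdd] at h1
    simp only [Nat.add_sub_cancel]
    generalize Nat.choose (2 * (c + 1) + 2) (c + 1) = X at *
    generalize Nat.choose (2 * (c + 1) + 1) c = Y at *
    apply lt_of_mul_lt_mul_right (a := c + 1) _ (by omega)
    calc 2 * (c + 1 + 1) * X * (c + 1) = 2 * (c + 2) * (2 * (c + 1) + 2) * Y := by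
          nlinarith [h1]
      _ < (4 * (2 * (c + 1) + 3) * (c + 1)) * Y := by
          apply Nat.mul_lt_mul_of_pos_right _ hp
          nlinarith
      _ = _ := by ring
  · intro a b hb hab
    obtain ⟨x, rfl⟩ : ∃ x, b = x + 2 := ⟨b - 2, by omega⟩
    obtain ⟨y, rfl⟩ : ∃ y, a = x + y + 4 := ⟨a - x - 4, by omega⟩
    have h1 := Nat.choose_succ_right_eq (x + y + 4 + (x + 2) + 2) (x + 2 + 1)
    have h2 : Nat.choose (x + y + 4 + (x + 2) + 2) (x + y + 4)
        = Nat.choose (x + y + 4 + (x + 2) + 2) (x + 2 + 1 + 1) :=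
      Nat.choose_symm_of_eq_add (by omega)
    have hp : 0 < Nat.choose (x + y + 4 + (x + 2) + 2) (x + 2 + 1) := Nat.choose_pos (by omega)
    rw [← h2] at h1
    have e : x + y + 4 + (x + 2) + 2 - (x + 2 + 1) = x + y + 5 := by omega
    rw [e] at h1
    generalize Nat.choose (x + y + 4 + (x + 2) + 2) (x + y + 4) = X at *
    generalize Nat.choose (x + y + 4 + (x + 2) + 2) (x + 2 + 1) = Y at *
    apply lt_of_mul_lt_mul_right (a := x + 4) _ (by omega)
    calc 3 * ((x + y + 4 + 2) * Y) * (x + 4) = (3 * (x + y + 6) * (x + 4)) * Y := by ring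
      _ < ((x + 3) * (x + y + 4 + (x + 2) + 4) * (x + y + 5)) * Y := by
          apply Nat.mul_lt_mul_of_pos_right _ hp
          have : (x + 3) * (x + y + 4 + (x + 2) + 4) * (x + y + 5) =
            3 * (x + y + 6) * (x + 4) + (2*x^3 + 3*x^2*y + x*y^2 + 23*x^2 + 3*y^2 + 21*x*y + 80*x + 33*y + 78) := by ring
          rw [this]
          omega
      _ = _ := by 
          have := congrArg (fun t => (x + 3) * (x + y + 4 + (x + 2) + 4) * t) h1
          linarith
end
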